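/- The assignment (L_𝔷, L₁, …, Lₙ) ↦ L_𝔷 ⊕ L₁ ⊕ … ⊕ Lₙ (internal sum of subspaces of V) is a bijection from the set of tuples in which L_𝔷 is a Lagrangian subspace of 𝔷 ⊕ 𝔷* and each Lᵢ is a Lagrangian subspace of 𝔤ᵢ ⊕ 𝔤ᵢ* stable under the adjoint–coadjoint action of 𝔤, onto the set of invariant Lagrangian subspaces of V = 𝔤 ⊕ 𝔤*. -/

import Mathlib

namespace QPar

variable (k g : Type*) [Field k] [LieRing g] [LieAlgebra k g]

/-- The canonical symplectic form ω on V = 𝔤 ⊕ 𝔤*: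
`ω((ξ,φ),(ξ',φ')) = φ(ξ') − φ'(ξ)`. -/
def omegaV (u v : g × Module.Dual k g) : k := u.2 v.1 - v.2 u.1

/-- The adjoint–coadjoint action of 𝔤 on V = 𝔤 ⊕ 𝔤*:
`η·(ξ,φ) = (⁅η,ξ⁆, −φ∘ad(η))`. -/
def adCoad (η : g) (v : g × Module.Dual k g) : g × Module.Dual k g :=
  (⁅η, v.1⁆, - (v.2 ∘ₗ (LieAlgebra.ad k g η : g →ₗ[k] g)))

/-- A subspace of V is invariant if it is stable under the adjoint–coadjoint action. -/
def IsInvariant (L : Submodule k (g × Module.Dual k g)) : Prop :=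
  ∀ η : g, ∀ v ∈ L, adCoad k g η v ∈ L

/-- A subspace of V is Lagrangian if it equals its ω-orthogonal complement. -/
def IsLagrangian (L : Submodule k (g × Module.Dual k g)) : Prop :=
  ∀ v : g × Module.Dual k g, v ∈ L ↔ ∀ w ∈ L, omegaV k g v w = 0

/-- `L` is a Lagrangian subspace of the subspace `W` of V, for the restriction of ω:
`L ⊆ W` and `L` equals its ω-orthogonal complement taken inside `W`. -/
def IsLagrangianIn (W L : Submodule k (g × Module.Dual k g)) : Prop :=
  L ≤ W ∧ ∀ v ∈ W, (v ∈ L ↔ ∀ w ∈ L, omegaV k g v w = 0)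

/-- The center of 𝔤, as a subspace. -/
def centerS : Submodule k g := (LieAlgebra.center k g).toSubmodule

/-- `I` is a simple ideal of 𝔤: an ideal which is nonabelian and has no
nontrivial proper ideals. -/
def IsSimpleIdeal (I : Submodule k g) : Prop :=
  (∀ η : g, ∀ x ∈ I, ⁅η, x⁆ ∈ I) ∧
  (∃ x ∈ I, ∃ y ∈ I, ⁅x, y⁆ ≠ 0) ∧
  ∀ J : Submodule k g, J ≤ I → (∀ x ∈ I, ∀ y ∈ J, ⁅x, y⁆ ∈ J) → J = ⊥ ∨ J = I

/-- 𝔷*, realized as the subspace of 𝔤* of functionals vanishing on all the 𝔤ᵢ. -/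
def zDual {n : ℕ} (gi : Fin n → Submodule k g) : Submodule k (Module.Dual k g) :=
  (⨆ i, gi i).dualAnnihilator

/-- 𝔤ᵢ*, realized as the subspace of 𝔤* of functionals vanishing on all the other
summands, i.e. on 𝔷 and on the 𝔤ⱼ for j ≠ i. -/
def giDual {n : ℕ} (gi : Fin n → Submodule k g) (i : Fin n) :
    Submodule k (Module.Dual k g) :=
  (centerS k g ⊔ ⨆ j, ⨆ _ : j ≠ i, gi j).dualAnnihilator

/-- The subspace 𝔷 ⊕ 𝔷* of V. -/
def zPart {n : ℕ} (gi : Fin n → Submodule k g) : Submodule k (g × Module.Dual k g) :=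
  (centerS k g).prod (zDual k g gi)

/-- The subspace 𝔤ᵢ ⊕ 𝔤ᵢ* of V. -/
def giPart {n : ℕ} (gi : Fin n → Submodule k g) (i : Fin n) :
    Submodule k (g × Module.Dual k g) :=
  (gi i).prod (giDual k g gi i)

end QPar

namespace QPar

section Helpers

variable {k g : Type*} [Field k] [LieRing g] [LieAlgebra k g]

/-- The endomorphism `(ξ, φ) ↦ (P ξ, φ ∘ P)` of `V` induced by an endomorphism `P` of `𝔤`. -/
def doubleMap (P : g →ₗ[k] g) : (g × Module.Dual k g) →ₗ[k] (g × Module.Dual k g) :=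
  P.prodMap (Module.Dual.transpose (R := k) P)

@[simp] lemma doubleMap_fst (P : g →ₗ[k] g) (v : g × Module.Dual k g) :
    (doubleMap P v).1 = P v.1 := rfl

@[simp] lemma doubleMap_snd_apply (P : g →ₗ[k] g) (v : g × Module.Dual k g) (x : g) :
    (doubleMap P v).2 x = v.2 (P x) := rfl

@[simp] lemma adCoad_fst (η : g) (v : g × Module.Dual k g) :
    (adCoad k g η v).1 = ⁅η, v.1⁆ := rfl

@[simp] lemma adCoad_snd_apply (η : g) (v : g × Module.Dual k g) (x : g) :
    (adCoad k g η v).2 x = -v.2 ⁅η, x⁆ := rfl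

lemma adCoad_add (η : g) (v w : g × Module.Dual k g) :
    adCoad k g η (v + w) = adCoad k g η v + adCoad k g η w := by
  refine Prod.ext (lie_add _ _ _) (LinearMap.ext fun x => ?_)
  simp [add_comm]

lemma adCoad_zero (η : g) : adCoad k g η 0 = 0 :=
  Prod.ext (lie_zero _) (LinearMap.ext fun x => by simp)

lemma omegaV_add_right (u v w : g × Module.Dual k g) :
    omegaV k g u (v + w) = omegaV k g u v + omegaV k g u w := by
  simp [omegaV]; ring

lemma omegaV_zero_right (u : g × Module.Dual k g) : omegaV k g u 0 = 0 := by
  simp [omegaV]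

lemma omegaV_doubleMap (P : g →ₗ[k] g) (u v : g × Module.Dual k g) :
    omegaV k g (doubleMap P u) v = omegaV k g u (doubleMap P v) := by
  simp [omegaV]

lemma IsInvariant.iSup {ι : Type*} {M : ι → Submodule k (g × Module.Dual k g)}
    (h : ∀ o, IsInvariant k g (M o)) : IsInvariant k g (⨆ o, M o) := by
  intro η v hv
  induction hv using Submodule.iSup_induction' with
  | mem i x hx => exact Submodule.mem_iSup_of_mem i (h i η x hx)
  | zero => rw [adCoad_zero]; exact zero_mem _
  | add x y _ _ hx hy => rw [adCoad_add]; exact add_mem hx hy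

/-- A simple ideal has trivial center. -/
lemma IsSimpleIdeal.eq_zero_of_lie_eq_zero {I : Submodule k g} (hI : IsSimpleIdeal k g I)
    {x : g} (hx : x ∈ I) (h : ∀ η ∈ I, ⁅η, x⁆ = 0) : x = 0 := by
  obtain ⟨-, ⟨a, ha, b, hb, hab⟩, hJ⟩ := hI
  let J : Submodule k g :=
    { carrier := {y | y ∈ I ∧ ∀ η ∈ I, ⁅η, y⁆ = 0}
      add_mem' := fun {y z} hy hz =>
        ⟨add_mem hy.1 hz.1, fun η hη => by rw [lie_add, hy.2 η hη, hz.2 η hη, add_zero]⟩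
      zero_mem' := ⟨zero_mem _, fun η _ => lie_zero η⟩
      smul_mem' := fun c y hy =>
        ⟨I.smul_mem c hy.1, fun η hη => by rw [lie_smul, hy.2 η hη, smul_zero]⟩ }
  rcases hJ J (fun y hy => hy.1)
    (fun η hη y hy => by rw [hy.2 η hη]; exact zero_mem _) with h0 | h1
  · have hxJ : x ∈ J := ⟨hx, h⟩
    rwa [h0, Submodule.mem_bot] at hxJ
  · have hbJ : b ∈ J := by rwa [h1]
    exact absurd (hbJ.2 a ha) hab

/-- A simple ideal is perfect: a functional killing its brackets kills it. -/
lemma IsSimpleIdeal.apply_eq_zero {I : Submodule k g} (hI : IsSimpleIdeal k g I)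
    {φ : Module.Dual k g} (h : ∀ η ∈ I, ∀ x ∈ I, φ ⁅η, x⁆ = 0) {x : g} (hx : x ∈ I) :
    φ x = 0 := by
  obtain ⟨hid, ⟨a, ha, b, hb, hab⟩, hJ⟩ := hI
  rcases hJ (I ⊓ LinearMap.ker φ) inf_le_left
    (fun η hη y hy => ⟨hid η y hy.1, h η hη y hy.1⟩) with h0 | h1
  · have hmem : ⁅a, b⁆ ∈ I ⊓ LinearMap.ker φ := ⟨hid a b hb, h a ha b hb⟩
    rw [h0, Submodule.mem_bot] at hmem
    exact absurd hmem hab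
  · rw [← h1] at hx
    exact hx.2

/-- An invariant subspace of `V` is stable under the projection of `V` onto `I ⊕ I*`, for a
simple ideal `I` with a complement centralizing it. -/
lemma IsInvariant.doubleMap_mem [FiniteDimensional k g]
    {L : Submodule k (g × Module.Dual k g)} (hL : IsInvariant k g L)
    {I : Submodule k g} (hI : IsSimpleIdeal k g I) {P : g →ₗ[k] g}
    (hP : ∀ x, P x ∈ I) (hPI : ∀ x ∈ I, P x = x) (hbr : ∀ η ∈ I, ∀ x, ⁅η, P x⁆ = ⁅η, x⁆)
    {v : g × Module.Dual k g} (hv : v ∈ L) : doubleMap P v ∈ L := by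
  have hbr_mem : ∀ η ∈ I, ∀ x, ⁅η, x⁆ ∈ I := fun η hη x => by
    rw [← hbr η hη]; exact hI.1 _ _ (hP x)
  have hfix : ∀ η ∈ I, ∀ w, doubleMap P (adCoad k g η w) = adCoad k g η w := by
    refine fun η hη w => Prod.ext (hPI _ (hbr_mem η hη _)) (LinearMap.ext fun x => ?_)
    simp [hbr η hη]
  let E : Submodule k (g × Module.Dual k g) := L ⊓ LinearMap.ker (doubleMap P - LinearMap.id)
  have hE : ∀ w, w ∈ E ↔ w ∈ L ∧ doubleMap P w = w := fun w => by
    simp [E, sub_eq_zero]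
  have hEact : ∀ η ∈ I, ∀ w ∈ L, adCoad k g η w ∈ E := fun η hη w hw =>
    (hE _).2 ⟨hL η w hw, hfix η hη w⟩
  have hfst : ∀ w ∈ L, ∃ κ ∈ E, κ.1 = P w.1 := by
    let A : Submodule k g := E.map (LinearMap.fst k g (Module.Dual k g))
    have hAI : A ≤ I := by
      rintro _ ⟨κ, hκ, rfl⟩
      have := congrArg Prod.fst ((hE κ).1 hκ).2
      change κ.1 ∈ I
      rw [← this]
      exact hP _
    have hAst : ∀ η ∈ I, ∀ y ∈ A, ⁅η, y⁆ ∈ A := by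
      rintro η hη _ ⟨κ, hκ, rfl⟩
      exact ⟨_, hEact η hη κ ((hE κ).1 hκ).1, rfl⟩
    intro w hw
    suffices h : P w.1 ∈ A by
      obtain ⟨κ, hκ, h⟩ := h
      exact ⟨κ, hκ, h⟩
    rcases hI.2.2 A hAI hAst with h0 | h1
    · rw [hI.eq_zero_of_lie_eq_zero (hP w.1)]
      · exact zero_mem _
      · intro η hη
        rw [hbr η hη]
        have : ⁅η, w.1⁆ ∈ A := ⟨_, hEact η hη w hw, rfl⟩
        rwa [h0, Submodule.mem_bot] at this
    · rw [h1]; exact hP _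
  have hsnd : ∀ w ∈ L, P w.1 = 0 → doubleMap P w ∈ L := by
    intro w hw hw0
    let E₀ : Submodule k (g × Module.Dual k g) :=
      E ⊓ LinearMap.ker (LinearMap.fst k g (Module.Dual k g))
    let B : Submodule k (Module.Dual k g) := E₀.map (LinearMap.snd k g (Module.Dual k g))
    have hBact : ∀ η ∈ I, ∀ u ∈ L, P u.1 = 0 → (adCoad k g η u).2 ∈ B := by
      intro η hη u hu hu0
      refine ⟨_, ⟨hEact η hη u hu, ?_⟩, rfl⟩
      change ⁅η, u.1⁆ = 0
      rw [← hbr η hη, hu0, lie_zero]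
    have hCst : ∀ η ∈ I, ∀ y ∈ I ⊓ B.dualCoannihilator, ⁅η, y⁆ ∈ I ⊓ B.dualCoannihilator := by
      intro η hη y hy
      refine ⟨hI.1 _ _ hy.1, (Submodule.mem_dualCoannihilator _).2 ?_⟩
      rintro _ ⟨κ, hκ, rfl⟩
      have h1 := hBact η hη κ ((hE κ).1 hκ.1).1 (by
        rw [show κ.1 = 0 from hκ.2, map_zero])
      have h2 := (Submodule.mem_dualCoannihilator _).1 hy.2 _ h1
      simpa using h2
    rcases hI.2.2 _ inf_le_left hCst with h0 | h1
    · have hmem : (doubleMap P w).2 ∈ B := by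
        rw [← Subspace.dualCoannihilator_dualAnnihilator_eq (W := B),
          Submodule.mem_dualAnnihilator]
        intro x hx
        have hPx : P x ∈ I ⊓ B.dualCoannihilator := by
          refine ⟨hP x, (Submodule.mem_dualCoannihilator _).2 ?_⟩
          rintro _ ⟨κ, hκ, rfl⟩
          have h3 := (Submodule.mem_dualCoannihilator _).1 hx κ.2 ⟨κ, hκ, rfl⟩
          have h4 := LinearMap.congr_fun (congrArg Prod.snd ((hE κ).1 hκ.1).2) x
          exact h4.trans h3
        rw [h0, Submodule.mem_bot] at hPx
        simp [hPx]
      obtain ⟨κ, hκ, hκw⟩ := hmem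
      have : doubleMap P w = κ :=
        Prod.ext (hw0.trans (show κ.1 = 0 from hκ.2).symm) hκw.symm
      rw [this]
      exact ((hE κ).1 hκ.1).1
    · have : doubleMap P w = 0 := by
        refine Prod.ext hw0 (LinearMap.ext fun x => ?_)
        refine hI.apply_eq_zero (φ := w.2) (fun η hη y hy => ?_) (hP x)
        rw [← h1] at hy
        have h2 := (Submodule.mem_dualCoannihilator _).1 hy.2 _ (hBact η hη w hw hw0)
        simpa using h2
      rw [this]
      exact zero_mem _
  obtain ⟨κ, hκ, hκv⟩ := hfst v hv
  obtain ⟨hκL, hκP⟩ := (hE κ).1 hκ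
  have h1 : P κ.1 = κ.1 := congrArg Prod.fst hκP
  have h2 := hsnd (v - κ) (sub_mem hv hκL) (by
    rw [Prod.fst_sub, map_sub, h1, hκv, sub_self])
  rw [map_sub, hκP] at h2
  simpa using add_mem h2 hκL

/-- The coordinate projections of an internal direct sum. -/
lemma exists_projections {ι : Type*} [Fintype ι] [DecidableEq ι] {d : ι → Submodule k g}
    (hd : DirectSum.IsInternal d) :
    ∃ P : ι → g →ₗ[k] g, (∀ o x, P o x ∈ d o) ∧ (∀ o, ∀ x ∈ d o, P o x = x) ∧
      (∀ o o', o ≠ o' → ∀ x ∈ d o', P o x = 0) ∧ ∀ x, ∑ o, P o x = x := by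
  let e := LinearEquiv.ofBijective (DirectSum.coeLinearMap d) hd
  have he : ∀ o (x : d o), e.symm (x : g) = DirectSum.lof k ι (fun o => d o) o x := by
    intro o x
    rw [LinearEquiv.symm_apply_eq]
    exact (DirectSum.coeLinearMap_lof d o x).symm
  refine ⟨fun o => (d o).subtype ∘ₗ DirectSum.component k ι (fun o => d o) o ∘ₗ
    e.symm.toLinearMap, fun o x => Submodule.coe_mem _, fun o x hx => ?_,
    fun o o' h x hx => ?_, fun x => ?_⟩
  · simp [he o ⟨x, hx⟩, DirectSum.component.lof_self]
  · simp [he o' ⟨x, hx⟩, DirectSum.component.of, h.symm]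
  · classical
    have h := e.apply_symm_apply x
    conv_rhs => rw [← h]
    change _ = DirectSum.coeLinearMap d (e.symm x)
    rw [DirectSum.coeLinearMap_eq_dfinsuppSum, DFinsupp.sum_eq_sum_fintype _ (by simp)]
    rfl

lemma sum_doubleMap {ι : Type*} [Fintype ι] {P : ι → g →ₗ[k] g}
    (hsum : ∀ x, ∑ o, P o x = x) (v : g × Module.Dual k g) :
    ∑ o, doubleMap (P o) v = v := by
  refine Prod.ext ?_ (LinearMap.ext fun x => ?_)
  · rw [Prod.fst_sum]; exact hsum v.1
  · rw [Prod.snd_sum, LinearMap.sum_apply]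
    simp only [doubleMap_snd_apply]
    rw [← map_sum, hsum]

lemma mem_prod_dualAnnihilator_iff {P : g →ₗ[k] g} {D C : Submodule k g}
    (hP : ∀ x, P x ∈ D) (hPD : ∀ x ∈ D, P x = x) (hC : LinearMap.ker P = C)
    (v : g × Module.Dual k g) :
    v ∈ D.prod C.dualAnnihilator ↔ doubleMap P v = v := by
  subst hC
  rw [Submodule.mem_prod, Submodule.mem_dualAnnihilator]
  constructor
  · rintro ⟨h1, h2⟩
    refine Prod.ext (hPD _ h1) (LinearMap.ext fun x => ?_)
    have := h2 (P x - x) (by rw [LinearMap.mem_ker, map_sub, hPD _ (hP x), sub_self])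
    rwa [map_sub, sub_eq_zero] at this
  · intro h
    rw [← h]
    refine ⟨hP _, fun x hx => ?_⟩
    rw [doubleMap_snd_apply, LinearMap.mem_ker.1 hx, map_zero]

lemma mem_iSup_iff_doubleMap_mem {ι : Type*} [Fintype ι] {P : ι → g →ₗ[k] g}
    (hsum : ∀ x, ∑ o, P o x = x) (horth : ∀ o o', o ≠ o' → ∀ x, P o (P o' x) = 0)
    {M : ι → Submodule k (g × Module.Dual k g)}
    (hM : ∀ o, ∀ v ∈ M o, doubleMap (P o) v = v) (v : g × Module.Dual k g) :
    v ∈ ⨆ o, M o ↔ ∀ o, doubleMap (P o) v ∈ M o := by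
  constructor
  · intro hv o
    induction hv using Submodule.iSup_induction' with
    | mem i x hx =>
      by_cases h : o = i
      · subst h; rwa [hM _ x hx]
      · have : doubleMap (P o) x = 0 := by
          rw [← hM i x hx]
          refine Prod.ext (horth o i h _) (LinearMap.ext fun y => ?_)
          simp [horth i o (Ne.symm h)]
        rw [this]
        exact zero_mem _
    | zero => rw [map_zero]; exact zero_mem _
    | add x y _ _ hx hy => rw [map_add]; exact add_mem hx hy
  · intro h
    rw [← sum_doubleMap hsum v]
    exact sum_mem fun o _ => Submodule.mem_iSup_of_mem o (h o)

/-- A sum of Lagrangian subspaces of the blocks is Lagrangian. -/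
lemma isLagrangian_iSup {ι : Type*} [Fintype ι] {P : ι → g →ₗ[k] g}
    (hsum : ∀ x, ∑ o, P o x = x) (horth : ∀ o o', o ≠ o' → ∀ x, P o (P o' x) = 0)
    (hidem : ∀ o x, P o (P o x) = P o x)
    {M W : ι → Submodule k (g × Module.Dual k g)}
    (hW : ∀ o v, v ∈ W o ↔ doubleMap (P o) v = v)
    (hM : ∀ o, IsLagrangianIn k g (W o) (M o)) : IsLagrangian k g (⨆ o, M o) := by
  have hMP : ∀ o, ∀ v ∈ M o, doubleMap (P o) v = v := fun o v hv => (hW o v).1 ((hM o).1 hv)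
  intro v
  have key : ∀ o, doubleMap (P o) v ∈ M o ↔ ∀ w ∈ M o, omegaV k g v w = 0 := by
    intro o
    have hvW : doubleMap (P o) v ∈ W o := by
      rw [hW]
      exact Prod.ext (hidem o _) (LinearMap.ext fun x => by simp [hidem])
    rw [(hM o).2 _ hvW]
    refine forall₂_congr fun w hw => ?_
    rw [omegaV_doubleMap, hMP o w hw]
  rw [mem_iSup_iff_doubleMap_mem hsum horth hMP]
  constructor
  · intro h w hw
    induction hw using Submodule.iSup_induction' with
    | mem i x hx => exact (key i).1 (h i) x hx
    | zero => exact omegaV_zero_right v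
    | add x y _ _ hx hy => rw [omegaV_add_right, hx, hy, add_zero]
  · exact fun h o => (key o).2 fun w hw => h w (Submodule.mem_iSup_of_mem o hw)

lemma IsLagrangian.isLagrangianIn_inf {P : g →ₗ[k] g} (hidem : ∀ x, P (P x) = P x)
    {W L : Submodule k (g × Module.Dual k g)} (hW : ∀ v, v ∈ W ↔ doubleMap P v = v)
    (hL : IsLagrangian k g L) (hLP : ∀ v ∈ L, doubleMap P v ∈ L) :
    IsLagrangianIn k g W (L ⊓ W) := by
  refine ⟨inf_le_right, fun v hv => ⟨fun h w hw => (hL v).1 h.1 w hw.1, fun h => ⟨?_, hv⟩⟩⟩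
  refine (hL v).2 fun w hw => ?_
  rw [← (hW v).1 hv, omegaV_doubleMap]
  refine h _ ⟨hLP w hw, (hW _).2 ?_⟩
  exact Prod.ext (hidem _) (LinearMap.ext fun x => by simp [hidem])

end Helpers

end QPar

/-- The assignment `(L_𝔷, L₁, …, Lₙ) ↦ L_𝔷 ⊕ L₁ ⊕ … ⊕ Lₙ` (internal sum
of subspaces of V) is a bijection from the set of tuples in which `L_𝔷` is a Lagrangian
subspace of `𝔷 ⊕ 𝔷*` and each `Lᵢ` is a Lagrangian subspace of `𝔤ᵢ ⊕ 𝔤ᵢ*` stable under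
the adjoint–coadjoint action of 𝔤, onto the set of invariant Lagrangian subspaces of
`V = 𝔤 ⊕ 𝔤*`. -/
theorem statement2
    (k g : Type*) [Field k] [CharZero k] [IsAlgClosed k]
    [LieRing g] [LieAlgebra k g] [FiniteDimensional k g]
    (n : ℕ) (gi : Fin n → Submodule k g)
    (hsimple : ∀ i, QPar.IsSimpleIdeal k g (gi i))
    (hdec : DirectSum.IsInternal (fun o : Option (Fin n) => o.elim (QPar.centerS k g) gi)) :
    Set.BijOn
      (fun p : Submodule k (g × Module.Dual k g) × (Fin n → Submodule k (g × Module.Dual k g)) =>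
        p.1 ⊔ ⨆ i, p.2 i)
      {p | QPar.IsLagrangianIn k g (QPar.zPart k g gi) p.1 ∧
        ∀ i, QPar.IsLagrangianIn k g (QPar.giPart k g gi i) (p.2 i) ∧
          QPar.IsInvariant k g (p.2 i)}
      {L | QPar.IsInvariant k g L ∧ QPar.IsLagrangian k g L} := by
  classical
  obtain ⟨P, hP, hPd, hP0, hsum⟩ := QPar.exists_projections hdec
  have hidem : ∀ o x, P o (P o x) = P o x := fun o x => hPd o _ (hP o x)
  have horth : ∀ o o', o ≠ o' → ∀ x, P o (P o' x) = 0 := fun o o' h x => hP0 o o' h _ (hP o' x)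
  have hideal : ∀ o : Option (Fin n), ∀ η : g, ∀ x ∈ o.elim (QPar.centerS k g) gi,
      ⁅η, x⁆ ∈ o.elim (QPar.centerS k g) gi := by
    rintro (_ | i) η x hx
    · exact lie_mem_right k g (LieAlgebra.center k g) η x hx
    · exact (hsimple i).1 η x hx
  have hcomm : ∀ o (η x : g), P o ⁅η, x⁆ = ⁅η, P o x⁆ := by
    intro o η x
    conv_lhs => rw [← hsum x, lie_sum, map_sum]
    rw [Finset.sum_eq_single o]
    · exact hPd o _ (hideal o η _ (hP o x))
    · exact fun o' _ h => hP0 o o' h.symm _ (hideal o' η _ (hP o' x))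
    · exact fun h => absurd (Finset.mem_univ o) h
  have hker : ∀ (o : Option (Fin n)) (C : Submodule k g), C ≤ LinearMap.ker (P o) →
      (∀ o', o' ≠ o → o'.elim (QPar.centerS k g) gi ≤ C) → LinearMap.ker (P o) = C := by
    intro o C h1 h2
    refine le_antisymm (fun x hx => ?_) h1
    rw [← hsum x]
    refine sum_mem fun o' _ => ?_
    by_cases h : o' = o
    · rw [h, LinearMap.mem_ker.1 hx]; exact zero_mem _
    · exact h2 o' h (hP o' x)
  let W : Option (Fin n) → Submodule k (g × Module.Dual k g) :=
    fun o => o.elim (QPar.zPart k g gi) (QPar.giPart k g gi)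
  have hW : ∀ o v, v ∈ W o ↔ QPar.doubleMap (P o) v = v := by
    rintro (_ | i) v
    · refine QPar.mem_prod_dualAnnihilator_iff (hP none) (hPd none) (hker _ _ ?_ ?_) v
      · exact iSup_le fun i x hx => hP0 none (some i) (by simp) x hx
      · rintro (_ | i) h
        · exact absurd rfl h
        · exact le_iSup gi i
    · refine QPar.mem_prod_dualAnnihilator_iff (hP (some i)) (hPd (some i)) (hker _ _ ?_ ?_) v
      · refine sup_le (fun x hx => hP0 (some i) none (by simp) x hx) ?_
        exact iSup₂_le fun j hj x hx => hP0 (some i) (some j) (by simpa using hj.symm) x hx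
      · rintro (_ | j) h
        · exact le_sup_left
        · exact le_sup_of_le_right (le_iSup₂_of_le j (by simpa using h) le_rfl)
  have hWact : ∀ o η, ∀ v ∈ W o, QPar.adCoad k g η v ∈ W o := by
    intro o η v hv
    rw [hW] at hv ⊢
    refine Prod.ext ?_ (LinearMap.ext fun x => ?_)
    · have h1 : P o v.1 = v.1 := congrArg Prod.fst hv
      simp [hcomm, h1]
    · have h2 : v.2 (P o ⁅η, x⁆) = v.2 ⁅η, x⁆ := LinearMap.congr_fun (congrArg Prod.snd hv) _
      simp [← hcomm, h2]
  have hzact : ∀ η, ∀ v ∈ W none, QPar.adCoad k g η v = 0 := by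
    intro η v hv
    refine Prod.ext (hv.1 η) (LinearMap.ext fun x => ?_)
    have h2 : v.2 (P none ⁅η, x⁆) = v.2 ⁅η, x⁆ :=
      LinearMap.congr_fun (congrArg Prod.snd ((hW none v).1 hv)) _
    have h3 : ⁅η, P none x⁆ = 0 := hP none x η
    rw [hcomm, h3, map_zero] at h2
    simp [← h2]
  have hproj : ∀ L : Submodule k (g × Module.Dual k g), QPar.IsInvariant k g L →
      ∀ o, ∀ v ∈ L, QPar.doubleMap (P o) v ∈ L := by
    intro L hL
    have hsome : ∀ i, ∀ v ∈ L, QPar.doubleMap (P (some i)) v ∈ L := by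
      refine fun i v hv => hL.doubleMap_mem (hsimple i) (hP (some i)) (hPd (some i)) ?_ hv
      intro η hη x
      rw [← hcomm]
      refine hPd (some i) _ ?_
      rw [← lie_skew]
      exact neg_mem ((hsimple i).1 x η hη)
    rintro (_ | i) v hv
    · have h := QPar.sum_doubleMap hsum v
      rw [Fintype.sum_option] at h
      rw [eq_sub_of_add_eq h]
      exact sub_mem hv (sum_mem fun i _ => hsome i v hv)
    · exact hsome i v hv
  have hsup : ∀ p : Submodule k (g × Module.Dual k g) ×
      (Fin n → Submodule k (g × Module.Dual k g)),
      p.1 ⊔ ⨆ i, p.2 i = ⨆ o : Option (Fin n), o.elim p.1 p.2 :=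
    fun p => (iSup_option_elim p.1 p.2).symm
  have hLag : ∀ p ∈ {p : Submodule k (g × Module.Dual k g) ×
      (Fin n → Submodule k (g × Module.Dual k g)) |
      QPar.IsLagrangianIn k g (QPar.zPart k g gi) p.1 ∧
        ∀ i, QPar.IsLagrangianIn k g (QPar.giPart k g gi i) (p.2 i) ∧
          QPar.IsInvariant k g (p.2 i)},
      ∀ o : Option (Fin n), QPar.IsLagrangianIn k g (W o) (o.elim p.1 p.2) := by
    rintro p hp (_ | i)
    · exact hp.1
    · exact (hp.2 i).1
  refine ⟨fun p hp => ?_, fun p hp q hq hpq => ?_, fun L hL => ?_⟩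
  · simp only [hsup]
    refine ⟨QPar.IsInvariant.iSup ?_, QPar.isLagrangian_iSup hsum horth hidem hW (hLag p hp)⟩
    rintro (_ | i)
    · intro η v hv
      rw [hzact η v (hp.1.1 hv)]
      exact zero_mem _
    · exact (hp.2 i).2
  · simp only [hsup] at hpq
    have hrec : ∀ p : Submodule k (g × Module.Dual k g) ×
        (Fin n → Submodule k (g × Module.Dual k g)),
        (∀ o : Option (Fin n), QPar.IsLagrangianIn k g (W o) (o.elim p.1 p.2)) →
        ∀ o : Option (Fin n), o.elim p.1 p.2 = (⨆ o : Option (Fin n), o.elim p.1 p.2) ⊓ W o := by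
      intro p hp o
      refine le_antisymm (le_inf (le_iSup (fun o : Option (Fin n) => o.elim p.1 p.2) o) (hp o).1) ?_
      rintro v ⟨hv, hvW⟩
      rw [← (hW o v).1 hvW]
      exact (QPar.mem_iSup_iff_doubleMap_mem hsum horth
        (fun o v hv => (hW o v).1 ((hp o).1 hv)) v).1 hv o
    have heq : ∀ o : Option (Fin n), o.elim p.1 p.2 = o.elim q.1 q.2 := fun o => by
      rw [hrec p (hLag p hp), hrec q (hLag q hq), hpq]
    exact Prod.ext (heq none) (funext fun i => heq (some i))
  · have hin : ∀ o, QPar.IsLagrangianIn k g (W o) (L ⊓ W o) := fun o =>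
      hL.2.isLagrangianIn_inf (hidem o) (hW o) (hproj L hL.1 o)
    refine ⟨(L ⊓ W none, fun i => L ⊓ W (some i)), ⟨hin none, fun i => ⟨hin (some i), ?_⟩⟩, ?_⟩
    · exact fun η v hv => ⟨hL.1 η v hv.1, hWact (some i) η v hv.2⟩
    · refine le_antisymm (sup_le inf_le_left (iSup_le fun i => inf_le_left)) fun v hv => ?_
      have hmem : ∀ o, QPar.doubleMap (P o) v ∈ L ⊓ W o := fun o =>
        ⟨hproj L hL.1 o v hv, (hW o _).2 <|
          Prod.ext (hidem o _) (LinearMap.ext fun x => by simp [hidem])⟩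
      rw [← QPar.sum_doubleMap hsum v, Fintype.sum_option]
      exact add_mem (Submodule.mem_sup_left (hmem none)) (Submodule.mem_sup_right
        (sum_mem fun i _ => Submodule.mem_iSup_of_mem i (hmem (some i))))
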